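/- Let Σ = (A,b) be a system of size (n,1) over a commutative von Neumann regular ring R, and suppose Σ is feedback equivalent to the canonical form (Ã, B̃) with B̃ = d_1·e⁽¹⁾ and Ã = S + A*, where d_1 | d_2 | … | d_n are idempotents, S ∈ R^{n×n} has S_{i+1,i} = d_{i+1} and zeros elsewhere, and A* = M_0 + … + M_{n−1} with each M_i vanishing outside the lower-right (n−i)×(n−i) block and satisfying M_i = d_i(1−d_{i+1})·M_i (d_0 := 1). Then the reachability matrix [b|Ab|…|A^{n−1}b] ∈ R^{n×n} is equivalent over R to the diagonal matrix diag(d_1,…,d_n); that is, the d_i are the idempotent invariant factors of the Smith form of the reachability matrix, and hence are uniquely determined by Σ. -/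

import Mathlib

open Matrix

/-- Feedback equivalence of linear systems `(A, B)` and `(A', B')`:
`A' = P(A + BK)P⁻¹` and `B' = PBQ` for some invertible `P`, `Q` and some `K`. -/
def FeedbackEquiv {n m : Type*} [Fintype n] [DecidableEq n] [Fintype m] [DecidableEq m]
    (R : Type*) [CommRing R]
    (A : Matrix n n R) (B : Matrix n m R)
    (A' : Matrix n n R) (B' : Matrix n m R) : Prop :=
  ∃ (P : GL n R) (Q : GL m R) (K : Matrix m n R),
    A' = (P : Matrix n n R) * (A + B * K) * ((P⁻¹ : GL n R) : Matrix n n R) ∧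
    B' = (P : Matrix n n R) * B * (Q : Matrix m m R)

/-- Two matrices are equivalent over `R` if `B' = P * B * Q`
for some invertible `P`, `Q`. -/
def MatrixEquivRel {n m : Type*} [Fintype n] [DecidableEq n] [Fintype m] [DecidableEq m]
    (R : Type*) [CommRing R] (B B' : Matrix n m R) : Prop :=
  ∃ (P : GL n R) (Q : GL m R), B' = (P : Matrix n n R) * B * (Q : Matrix m m R)

/-- Powers of a closed-loop matrix applied to a single input are unitriangular combinations of
the open-loop ones. -/
theorem exists_coeff_closedLoop_pow_mul {R ι : Type*} [CommRing R] [Fintype ι] [DecidableEq ι]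
    (A : Matrix ι ι R) (b : Matrix ι (Fin 1) R) (K : Matrix (Fin 1) ι R) (j : ℕ) :
    ∃ c : ℕ → R, c j = 1 ∧ (∀ i, j < i → c i = 0) ∧
      (A + b * K) ^ j * b = ∑ i ∈ Finset.range (j + 1), c i • (A ^ i * b) := by
  induction j with
  | zero => exact ⟨fun i => if i = 0 then 1 else 0, by simp, fun i hi => by simp; omega, by simp⟩
  | succ j ih =>
    obtain ⟨c, hc, hc0, h⟩ := ih
    refine ⟨fun i => Nat.casesOn i ((K * ((A + b * K) ^ j * b)) 0 0) c, hc, fun i hi => ?_, ?_⟩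
    · cases i with
      | zero => omega
      | succ i => exact hc0 i (by omega)
    · have hb : ∀ X : Matrix (Fin 1) (Fin 1) R, b * X = X 0 0 • b := by
        intro X
        ext p q
        fin_cases q
        simpa [Matrix.mul_apply] using mul_comm _ _
      rw [Finset.sum_range_succ', pow_succ', Matrix.mul_assoc, Matrix.add_mul, Matrix.mul_assoc b,
        hb]
      congr 1
      · rw [h, Matrix.mul_sum]
        refine Finset.sum_congr rfl fun i _ => ?_
        rw [Matrix.mul_smul, pow_succ', Matrix.mul_assoc]
      · simp

/-- Conjugation commutes with forming powers. -/
theorem conj_pow_mul {R ι κ : Type*} [CommRing R] [Fintype ι] [DecidableEq ι] [Fintype κ]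
    (P : GL ι R) (Q : Matrix κ κ R) (A : Matrix ι ι R) (b : Matrix ι κ R) (j : ℕ) :
    ((P : Matrix ι ι R) * A * ((P⁻¹ : GL ι R) : Matrix ι ι R)) ^ j * ((P : Matrix ι ι R) * b * Q) =
      (P : Matrix ι ι R) * (A ^ j * b) * Q := by
  induction j with
  | zero => simp
  | succ j ih =>
    have hP : ((P⁻¹ : GL ι R) : Matrix ι ι R) * (P : Matrix ι ι R) = 1 := by
      rw [← Units.val_mul, inv_mul_cancel, Units.val_one]
    rw [pow_succ', Matrix.mul_assoc, ih, pow_succ']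
    simp only [Matrix.mul_assoc]
    rw [← Matrix.mul_assoc _ (P : Matrix ι ι R), hP, Matrix.one_mul]

/-- Feedback equivalent single-input systems have equivalent reachability matrices. -/
theorem FeedbackEquiv.reachability_equiv {R : Type*} [CommRing R] {n : ℕ}
    {A A' : Matrix (Fin n) (Fin n) R} {b b' : Matrix (Fin n) (Fin 1) R}
    (h : FeedbackEquiv R A b A' b') :
    MatrixEquivRel R (Matrix.of fun (i j : Fin n) => (A ^ (j : ℕ) * b) i 0)
      (Matrix.of fun (i j : Fin n) => (A' ^ (j : ℕ) * b') i 0) := by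
  obtain ⟨P, Q, K, rfl, rfl⟩ := h
  choose c hc1 hc0 hc using exists_coeff_closedLoop_pow_mul A b K
  have hQ : IsUnit ((Q : Matrix (Fin 1) (Fin 1) R) 0 0) := by
    have := (Matrix.isUnit_iff_isUnit_det _).1 Q.isUnit
    rwa [Matrix.det_fin_one] at this
  let V : Matrix (Fin n) (Fin n) R :=
    (Q : Matrix (Fin 1) (Fin 1) R) 0 0 • Matrix.of fun i j : Fin n => c j i
  have hV : IsUnit V := by
    rw [Matrix.isUnit_iff_isUnit_det, Matrix.det_smul, Matrix.det_of_isUpperTriangular]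
    · simpa [hc1] using hQ.pow n
    · intro i j hij
      exact hc0 _ _ hij
  refine ⟨P, hV.unit, ?_⟩
  rw [IsUnit.unit_spec, Matrix.mul_assoc (P : Matrix (Fin n) (Fin n) R) (Matrix.of _) V]
  have hcol : ∀ i j : Fin n, ((A + b * K) ^ (j : ℕ) * b) i 0 =
      ∑ k : Fin n, (A ^ (k : ℕ) * b) i 0 * c j k := by
    intro i j
    rw [hc, Matrix.sum_apply, Finset.sum_subset (Finset.range_mono j.2), Finset.sum_range]
    · simp [mul_comm]
    · intro k _ hk
      rw [hc0 _ _ (by simpa using hk)]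
      simp
  have key : (Matrix.of fun i j : Fin n => (A ^ (j : ℕ) * b) i 0) * V =
      (Q : Matrix (Fin 1) (Fin 1) R) 0 0 •
        Matrix.of fun i j : Fin n => ((A + b * K) ^ (j : ℕ) * b) i 0 := by
    rw [Matrix.mul_smul]
    congr 1
    ext i j
    simp only [Matrix.mul_apply (M := Matrix.of _), Matrix.of_apply, hcol]
  rw [key]
  ext i j
  rw [Matrix.of_apply, conj_pow_mul, Matrix.mul_apply]
  simp only [Fin.sum_univ_one, Fin.isValue, Matrix.mul_apply (M := (P : Matrix (Fin n) (Fin n) R)),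
    Matrix.smul_apply, Matrix.of_apply, smul_eq_mul, Finset.sum_mul]
  exact Finset.sum_congr rfl fun k _ => by ring

/-- In a divisibility chain of idempotents, each is absorbed by the later ones. -/
theorem idempotent_chain_mul {R : Type*} [CommRing R] {n : ℕ} {d : ℕ → R}
    (hidem : ∀ j : ℕ, 1 ≤ j → j ≤ n → IsIdempotentElem (d j))
    (hchain : ∀ j : ℕ, 1 ≤ j → j < n → d j * d (j + 1) = d (j + 1))
    {i j : ℕ} (hi : 1 ≤ i) (hij : i ≤ j) (hj : j ≤ n) : d i * d j = d j := by
  induction j, hij using Nat.le_induction with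
  | base => exact hidem i hi hj
  | succ j hij ih =>
    rw [← hchain j (by omega) (by omega), ← mul_assoc, ih (by omega)]

/-- if a single-input system `(A, b)` over a commutative von
Neumann regular ring is feedback equivalent to the canonical form `(Ã, B̃)`
(`B̃ = d₁·e⁽¹⁾`, `Ã = S + M₀ + ⋯ + M_{n-1}`, with a chain of idempotents
`d₁ | ⋯ | dₙ`, `d 0 = 1` by convention), then the reachability matrix
`[b | Ab | ⋯ | A^(n-1)b]` is equivalent over `R` to `diag(d₁, …, dₙ)`;
i.e. the `dᵢ` are the idempotent invariant factors of its Smith form. -/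
theorem single_input_invariant_factors
    {R : Type*} [CommRing R]
    (hreg : ∀ a : R, ∃ x : R, a ^ 2 * x = a)
    {n : ℕ}
    (A : Matrix (Fin n) (Fin n) R) (b : Matrix (Fin n) (Fin 1) R)
    (d : ℕ → R)
    (hd0 : d 0 = 1)
    (hidem : ∀ j : ℕ, 1 ≤ j → j ≤ n → IsIdempotentElem (d j))
    (hchain : ∀ j : ℕ, 1 ≤ j → j < n → d j * d (j + 1) = d (j + 1))
    (M : Fin n → Matrix (Fin n) (Fin n) R)
    (hMblock : ∀ (i p q : Fin n), ((p : ℕ) < (i : ℕ) ∨ (q : ℕ) < (i : ℕ)) → M i p q = 0)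
    (hMd : ∀ i : Fin n, M i = (d (i : ℕ) * (1 - d ((i : ℕ) + 1))) • M i)
    (Atil : Matrix (Fin n) (Fin n) R)
    (hAtil : Atil = (Matrix.of fun p q : Fin n =>
        if (p : ℕ) = (q : ℕ) + 1 then d ((p : ℕ) + 1) else 0) + ∑ i, M i)
    (Btil : Matrix (Fin n) (Fin 1) R)
    (hBtil : Btil = Matrix.of fun (p : Fin n) (_ : Fin 1) =>
        if (p : ℕ) = 0 then d 1 else 0)
    (hfe : FeedbackEquiv R A b Atil Btil) :
    MatrixEquivRel R
      (Matrix.of fun (i j : Fin n) => (A ^ (j : ℕ) * b) i 0)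
      (Matrix.of fun (i j : Fin n) => if i = j then d ((i : ℕ) + 1) else 0) := by
  have hreach : ∀ j : ℕ, j < n → Atil ^ j * Btil =
      Matrix.of fun (p : Fin n) (_ : Fin 1) => if (p : ℕ) = j then d (j + 1) else 0 := by
    intro j
    induction j with
    | zero => intro _; simpa using hBtil
    | succ j ih =>
      intro hj
      have hMj : ∀ i p : Fin n, M i p ⟨j, by omega⟩ * d (j + 1) = 0 := by
        intro i p
        by_cases hi : j < (i : ℕ)
        · rw [hMblock i p _ (Or.inr hi), zero_mul]
        · rw [hMd i, Matrix.smul_apply, smul_eq_mul]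
          have := idempotent_chain_mul hidem hchain (i := (i : ℕ) + 1) (j := j + 1)
            (by omega) (by omega) (by omega)
          linear_combination (-d (i : ℕ) * M i p ⟨j, by omega⟩) * this
      rw [pow_succ', Matrix.mul_assoc, ih (by omega)]
      ext p q
      rw [Matrix.mul_apply, Finset.sum_eq_single (⟨j, by omega⟩ : Fin n)]
      · simp only [hAtil, Matrix.add_apply, Matrix.of_apply, Matrix.sum_apply, if_true, add_mul,
          Finset.sum_mul, hMj, Finset.sum_const_zero, add_zero]
        split_ifs with hp
        · rw [hp, mul_comm, hchain (j + 1) (by omega) hj]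
        · rw [zero_mul]
      · intro k _ hk
        have hkj : (k : ℕ) ≠ j := fun h => hk (Fin.ext h)
        simp [hkj]
      · simp
  have hdiag : (Matrix.of fun i j : Fin n => (Atil ^ (j : ℕ) * Btil) i 0) =
      Matrix.of fun i j : Fin n => if i = j then d ((i : ℕ) + 1) else 0 := by
    ext i j
    rw [Matrix.of_apply, hreach j j.2]
    by_cases h : i = j
    · simp [h]
    · simp [h, Fin.val_inj]
  exact hdiag ▸ hfe.reachability_equiv
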